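/- arXiv:1804.01157 — 9 statements merged into one kernel-verified Lean document; each statement's English description precedes it below -/
import Mathlib

section
/- For all λ, μ ∈ ℝ and every unit vector n = (n₁, n₂) ∈ ℝ² (i.e., n₁² + n₂² = 1), the determinant of the 4×4 matrix N(λ,μ,n) equals μ(λ + 2μ). Consequently, N(λ,μ,n) is invertible whenever μ(λ + 2μ) ≠ 0. -/
open Matrix

noncomputable section

/-- The 4×4 matrix `N(λ,μ,n)` associated with the elasticity interface jump conditions. -/
def Nmat (lam mu n1 n2 : ℝ) : Matrix (Fin 4) (Fin 4) ℝ :=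
  !![(lam + 2*mu)*n1, mu*n2, mu*n2, lam*n1;
     lam*n2, mu*n1, mu*n1, (lam + 2*mu)*n2;
     -n2, 0, n1, 0;
     0, -n2, 0, n1]

theorem det_Nmat_eq_mul_sq (lam mu n1 n2 : ℝ) :
    (Nmat lam mu n1 n2).det = mu * (lam + 2*mu) * (n1^2 + n2^2)^2 := by
  simp [Nmat, Matrix.det_succ_row_zero, Fin.sum_univ_succ, Fin.succAbove]
  ring

/-- for every unit vector `n`, `det N(λ,μ,n) = μ(λ+2μ)`; consequently `N(λ,μ,n)`
is invertible whenever `μ(λ+2μ) ≠ 0`. -/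
theorem det_Nmat (lam mu n1 n2 : ℝ) (hn : n1^2 + n2^2 = 1) :
    (Nmat lam mu n1 n2).det = mu * (lam + 2*mu) ∧
    (mu * (lam + 2*mu) ≠ 0 → IsUnit (Nmat lam mu n1 n2)) := by
  have hdet : (Nmat lam mu n1 n2).det = mu * (lam + 2*mu) := by
    rw [det_Nmat_eq_mul_sq, hn, one_pow, mul_one]
  refine ⟨hdet, fun h => ?_⟩
  rw [Matrix.isUnit_iff_isUnit_det, hdet]
  exact h.isUnit
end
end

section
/- For all real numbers d, e with 0 < d ≤ 1 and 0 < e ≤ 1, the following inequality holds: (e²(1−d) + d²(1−e+e²))²·(d+e)² ≥ d²e²·(e²(1−d) − d²(1−e))². Equivalently, the quantity (−d²e²(e²(1−d)−d²(1−e))² + (e²(1−d)+d²(1−e+e²))²(d+e)²)/((d²+e²)²(d+e)²), which equals (1 − g_n(F₀))² − g_t(F₀)² in the bilinear Case 1 configuration, is nonnegative. -/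
/-- the key polynomial inequality of Lemma 5.1 for the bilinear Case 1
configuration: for `0 < d ≤ 1`, `0 < e ≤ 1`,
`(e²(1−d) + d²(1−e+e²))²(d+e)² ≥ d²e²(e²(1−d) − d²(1−e))²`; equivalently, the quantity
`(1 − g_n(F₀))² − g_t(F₀)²` is nonnegative. -/
theorem bilinear_case1_key_inequality (d e : ℝ) (hd0 : 0 < d) (hd1 : d ≤ 1)
    (he0 : 0 < e) (he1 : e ≤ 1) :
    (e^2*(1 - d) + d^2*(1 - e + e^2))^2 * (d + e)^2
      ≥ d^2 * e^2 * (e^2*(1 - d) - d^2*(1 - e))^2 ∧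
    0 ≤ (-(d^2 * e^2 * (e^2*(1 - d) - d^2*(1 - e))^2)
          + (e^2*(1 - d) + d^2*(1 - e + e^2))^2 * (d + e)^2)
        / ((d^2 + e^2)^2 * (d + e)^2) := by
  have hA : 0 ≤ e^2*(1 - d) := mul_nonneg (sq_nonneg e) (by linarith)
  have hB : 0 ≤ d^2*(1 - e) := mul_nonneg (sq_nonneg d) (by linarith)
  have hde : 0 < d * e := mul_pos hd0 he0
  have hle : d * e ≤ d + e := by nlinarith
  have hsum : e^2*(1 - d) + d^2*(1 - e) ≤ e^2*(1 - d) + d^2*(1 - e + e^2) := by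
    nlinarith [sq_nonneg (d * e)]
  have hmul : d * e * (e^2*(1 - d) + d^2*(1 - e))
      ≤ (d + e) * (e^2*(1 - d) + d^2*(1 - e + e^2)) :=
    mul_le_mul hle hsum (add_nonneg hA hB) (by positivity)
  have hsq : (d * e * (e^2*(1 - d) - d^2*(1 - e)))^2
      ≤ ((d + e) * (e^2*(1 - d) + d^2*(1 - e + e^2)))^2 := by
    apply sq_le_sq'
    · linarith [mul_nonneg hde.le hA]
    · linarith [mul_nonneg hde.le hB]
  have key : (e^2*(1 - d) + d^2*(1 - e + e^2))^2 * (d + e)^2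
      ≥ d^2 * e^2 * (e^2*(1 - d) - d^2*(1 - e))^2 := by
    simpa only [mul_pow, mul_comm ((d + e)^2)] using hsq
  exact ⟨key, div_nonneg (by linarith) (by positivity)⟩
end

section
/- Let K be an invertible 2×2 real matrix, let m ≥ 1, let L₁, …, L_m ∈ ℝ, and let Ψ₁, …, Ψ_m be 2×2 real matrices. Let A be the 2m×2m real block matrix whose (j,k) block (1 ≤ j, k ≤ m) is δ_{jk}·K + L_j·Ψ_kᵀ. Then A is invertible if and only if the 2×2 matrix K + Σ_{j=1}^m L_j·Ψ_jᵀ is invertible. -/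
open Matrix

noncomputable section

open scoped Kronecker in
/-- The block matrix with blocks `δ_{jk} K + L_j Φ_k` is invertible if and only if
`K + ∑ j, L_j Φ_j` is. -/
theorem isUnit_blockDiagonal_add_iff {R ι n : Type*} [CommRing R] [Fintype ι] [DecidableEq ι]
    [Fintype n] [DecidableEq n] (K : Matrix n n R) (hK : IsUnit K) (L : ι → R)
    (Φ : ι → Matrix n n R) :
    IsUnit (Matrix.of fun (jp kq : ι × n) =>
        (if jp.1 = kq.1 then K jp.2 kq.2 else 0) + L jp.1 * Φ kq.1 jp.2 kq.2)
      ↔ IsUnit (K + ∑ j, L j • Φ j) := by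
  have hdet : IsUnit K.det := (Matrix.isUnit_iff_isUnit_det K).mp hK
  let U : Matrix (ι × n) n R := Matrix.of fun jp r => L jp.1 * (1 : Matrix n n R) jp.2 r
  let V : Matrix n (ι × n) R := Matrix.of fun r kq => (Φ kq.1 * K⁻¹) r kq.2
  have hA : (Matrix.of fun (jp kq : ι × n) =>
      (if jp.1 = kq.1 then K jp.2 kq.2 else 0) + L jp.1 * Φ kq.1 jp.2 kq.2)
      = (1 + U * V) * ((1 : Matrix ι ι R) ⊗ₖ K) := by
    have hUV (j k : ι) (p r : n) : (U * V) (j, p) (k, r) = L j * (Φ k * K⁻¹) p r := by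
      simp [U, V, Matrix.mul_apply, Matrix.one_apply]
    ext ⟨j, p⟩ ⟨k, q⟩
    rw [add_mul, one_mul, Matrix.add_apply, Matrix.mul_apply, Fintype.sum_prod_type]
    have hΦ : Φ k p q = ∑ r, (Φ k * K⁻¹) p r * K r q := by
      rw [← Matrix.mul_apply, Matrix.nonsing_inv_mul_cancel_right _ _ hdet]
    simp [hUV, Matrix.kroneckerMap_apply, Matrix.one_apply, hΦ, Finset.mul_sum, mul_assoc]
  have hVU : K + ∑ j, L j • Φ j = (1 + V * U) * K := by
    have h : V * U = ∑ j, L j • (Φ j * K⁻¹) := by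
      ext p q
      simp [U, V, Matrix.mul_apply, Matrix.one_apply, Fintype.sum_prod_type, Matrix.sum_apply,
        mul_comm (L _)]
    simp [h, add_mul, Finset.sum_mul, Matrix.nonsing_inv_mul_cancel_right _ _ hdet]
  rw [hA, hVU, Matrix.isUnit_iff_isUnit_det, Matrix.isUnit_iff_isUnit_det (_ * K),
    Matrix.det_mul, Matrix.det_mul, Matrix.det_one_add_mul_comm, Matrix.det_kronecker]
  simp [IsUnit.mul_iff, hdet.pow]
  tauto

/-- the generalized Sherman–Morrison block matrix `A`, with 2×2 blocks
`A_{jk} = δ_{jk}K + L_j·Ψ_kᵀ`, is invertible if and only if the 2×2 matrix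
`K + Σ_j L_j·Ψ_jᵀ` is invertible. -/
theorem sherman_morrison_block_isUnit_iff (K : Matrix (Fin 2) (Fin 2) ℝ) (hK : IsUnit K)
    (m : ℕ) (hm : 1 ≤ m) (L : Fin m → ℝ) (Ψ : Fin m → Matrix (Fin 2) (Fin 2) ℝ) :
    IsUnit (Matrix.of fun (jp kq : Fin m × Fin 2) =>
        (if jp.1 = kq.1 then K jp.2 kq.2 else 0) + L jp.1 * Ψ kq.1 kq.2 jp.2)
      ↔ IsUnit (K + ∑ j, L j • (Ψ j)ᵀ) := by
  exact isUnit_blockDiagonal_add_iff K hK L fun j => (Ψ j)ᵀ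
end
end

section
/- Let λ⁺, λ⁻, μ⁺, μ⁻ ∈ ℝ, set λ̂ = λ⁺ − λ⁻ and μ̂ = μ⁺ − μ⁻, let n̄ = (n̄₁, n̄₂) ∈ ℝ² be a unit vector with t̄ = (n̄₂, −n̄₁), let Q be the 2×2 matrix with columns n̄ and t̄, and let K be the 2×2 matrix with entries K₁₁ = n̄₁²(λ⁻+μ⁻) + μ⁻, K₁₂ = K₂₁ = n̄₁n̄₂(λ⁻+μ⁻), K₂₂ = n̄₂²(λ⁻+μ⁻) + μ⁻. For a ∈ ℝ², let Ψ(a) be the 2×2 matrix with first row ((λ̂+2μ̂)a₁n̄₁ + μ̂a₂n̄₂, λ̂a₁n̄₂ + μ̂a₂n̄₁) and second row (λ̂a₂n̄₁ + μ̂a₁n̄₂, μ̂a₁n̄₁ + (λ̂+2μ̂)a₂n̄₂). Then for any m ≥ 1 and any L₁, …, L_m ∈ ℝ, a₁, …, a_m ∈ ℝ², setting g_n = Σ_j L_j·(a_j·n̄) and g_t = Σ_j L_j·(a_j·t̄), one has Q·(K + Σ_{j=1}^m L_j·Ψ(a_j)ᵀ)·Qᵀ = [[λ⁻+2μ⁻+(λ̂+2μ̂)g_n,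 λ̂·g_t], [μ̂·g_t, μ⁻+μ̂·g_n]]. -/
open Matrix

noncomputable section

/-- The 2×2 matrix `K` arising in the construction of the IFE shape functions. -/
def Kmat (lam mu n1 n2 : ℝ) : Matrix (Fin 2) (Fin 2) ℝ :=
  !![n1^2*(lam + mu) + mu, n1*n2*(lam + mu);
     n1*n2*(lam + mu), n2^2*(lam + mu) + mu]

/-- The 2×2 matrix `Ψ(a)` whose rows are `σ̂((ψ,0))·n̄` and `σ̂((0,ψ))·n̄` for a scalar
function `ψ` with gradient `a` at the anchor point. -/
def PsiMat (lh mh n1 n2 a1 a2 : ℝ) : Matrix (Fin 2) (Fin 2) ℝ :=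
  !![(lh + 2*mh)*a1*n1 + mh*a2*n2, lh*a1*n2 + mh*a2*n1;
     lh*a2*n1 + mh*a1*n2, mh*a1*n1 + (lh + 2*mh)*a2*n2]

theorem sum_smul_transpose_PsiMat {ι : Type*} (s : Finset ι) (lh mh n1 n2 : ℝ) (L x y : ι → ℝ) :
    ∑ j ∈ s, L j • (PsiMat lh mh n1 n2 (x j) (y j))ᵀ
      = (PsiMat lh mh n1 n2 (∑ j ∈ s, L j * x j) (∑ j ∈ s, L j * y j))ᵀ := by
  ext i k
  fin_cases i <;> fin_cases k <;>
    simp [PsiMat, Matrix.sum_apply, Finset.mul_sum, Finset.sum_mul, ← Finset.sum_add_distrib] <;>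
    exact Finset.sum_congr rfl fun j _ => by ring

theorem congruence_Kmat_add_PsiMat (l u lh mh n1 n2 x y : ℝ) (hn : n1^2 + n2^2 = 1) :
    !![n1, n2; n2, -n1] * (Kmat l u n1 n2 + (PsiMat lh mh n1 n2 x y)ᵀ) * (!![n1, n2; n2, -n1])ᵀ
      = !![l + 2*u + (lh + 2*mh)*(x*n1 + y*n2), lh*(x*n2 - y*n1);
           mh*(x*n2 - y*n1), u + mh*(x*n1 + y*n2)] := by
  ext i k
  fin_cases i <;> fin_cases k <;>
    simp [Kmat, PsiMat, vecMul, dotProduct, Matrix.mul_apply]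
  · linear_combination
      ((l + u)*(n1^2 + n2^2 + 1) + u + (lh + 2*mh)*(x*n1 + y*n2)) * hn
  · linear_combination lh*(x*n2 - y*n1) * hn
  · linear_combination mh*(x*n2 - y*n1) * hn
  · linear_combination (u + mh*(x*n1 + y*n2)) * hn

/-- the congruence identity
`Q·(K + Σ_j L_j·Ψ(a_j)ᵀ)·Qᵀ = [[λ⁻+2μ⁻+(λ̂+2μ̂)g_n, λ̂g_t],[μ̂g_t, μ⁻+μ̂g_n]]`,
with `g_n = Σ_j L_j(a_j·n̄)` and `g_t = Σ_j L_j(a_j·t̄)`. -/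
theorem xi_congruence_identity (lp lm mp mm n1 n2 : ℝ) (hn : n1^2 + n2^2 = 1)
    (m : ℕ) (hm : 1 ≤ m) (L : Fin m → ℝ) (a : Fin m → Fin 2 → ℝ) :
    let lh := lp - lm
    let mh := mp - mm
    let gn := ∑ j, L j * (a j 0 * n1 + a j 1 * n2)
    let gt := ∑ j, L j * (a j 0 * n2 - a j 1 * n1)
    !![n1, n2; n2, -n1]
        * (Kmat lm mm n1 n2 + ∑ j, L j • (PsiMat lh mh n1 n2 (a j 0) (a j 1))ᵀ)
        * (!![n1, n2; n2, -n1])ᵀ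
      = !![lm + 2*mm + (lh + 2*mh)*gn, lh*gt; mh*gt, mm + mh*gn] := by
  intro lh mh gn gt
  have hgn : gn = (∑ j, L j * a j 0) * n1 + (∑ j, L j * a j 1) * n2 := by
    simp only [gn, Finset.sum_mul, ← Finset.sum_add_distrib]
    exact Finset.sum_congr rfl fun j _ => by ring
  have hgt : gt = (∑ j, L j * a j 0) * n2 - (∑ j, L j * a j 1) * n1 := by
    simp only [gt, Finset.sum_mul, ← Finset.sum_sub_distrib]
    exact Finset.sum_congr rfl fun j _ => by ring
  rw [sum_smul_transpose_PsiMat, congruence_Kmat_add_PsiMat _ _ _ _ _ _ _ _ hn, hgn, hgt]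
end
end

section
/- Let λ⁺ > 0, λ⁻ > 0, μ⁺ > 0, μ⁻ > 0, and let g_n, g_t ∈ ℝ satisfy 0 ≤ g_n ≤ 1, g_t² ≤ g_n², and g_t² ≤ (1 − g_n)². Setting λ̂ = λ⁺ − λ⁻ and μ̂ = μ⁺ − μ⁻, the determinant of the 2×2 matrix Ξ = [[λ⁻+2μ⁻+(λ̂+2μ̂)g_n, λ̂·g_t], [μ̂·g_t, μ⁻+μ̂·g_n]] satisfies det Ξ > 2·(min{μ⁺, μ⁻})². In particular, Ξ is invertible. -/
open Matrix

/-- The interpolated value `b + (a - b) * g` of two positive numbers dominates their difference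
scaled by any `t` with `|t| ≤ min g (1 - g)`. -/
lemma abs_sub_mul_lt_interpolation {a b g t : ℝ} (ha : 0 < a) (hb : 0 < b)
    (h₁ : |t| ≤ g) (h₂ : |t| ≤ 1 - g) : |(a - b) * t| < b + (a - b) * g := by
  rw [abs_mul]
  rcases le_total b a with h | h
  · rw [abs_of_nonneg (sub_nonneg.2 h)]
    nlinarith [mul_le_mul_of_nonneg_left h₁ (sub_nonneg.2 h)]
  · rw [abs_of_nonpos (sub_nonpos.2 h)]
    nlinarith [mul_le_mul_of_nonneg_left h₂ (sub_nonneg.2 h)]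

lemma min_le_interpolation {a b g : ℝ} (h₀ : 0 ≤ g) (h₁ : g ≤ 1) :
    min a b ≤ b + (a - b) * g := by
  nlinarith [mul_le_mul_of_nonneg_left (min_le_left a b) h₀,
    mul_le_mul_of_nonneg_left (min_le_right a b) (sub_nonneg.2 h₁)]

/-- with positive Lamé parameters and `0 ≤ g_n ≤ 1`, `g_t² ≤ g_n²`,
`g_t² ≤ (1−g_n)²`, the matrix `Ξ` satisfies `det Ξ > 2(min{μ⁺,μ⁻})²`; in particular `Ξ`
is invertible. -/
theorem det_Xi_lower_bound (lp lm mp mm gn gt : ℝ)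
    (hlp : 0 < lp) (hlm : 0 < lm) (hmp : 0 < mp) (hmm : 0 < mm)
    (hgn0 : 0 ≤ gn) (hgn1 : gn ≤ 1) (hgt1 : gt^2 ≤ gn^2) (hgt2 : gt^2 ≤ (1 - gn)^2) :
    let lh := lp - lm
    let mh := mp - mm
    let Xi : Matrix (Fin 2) (Fin 2) ℝ :=
      !![lm + 2*mm + (lh + 2*mh)*gn, lh*gt; mh*gt, mm + mh*gn]
    2 * (min mp mm)^2 < Xi.det ∧ IsUnit Xi := by
  intro lh mh Xi
  have ht₁ : |gt| ≤ gn := abs_le_of_sq_le_sq hgt1 hgn0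
  have ht₂ : |gt| ≤ 1 - gn := abs_le_of_sq_le_sq hgt2 (sub_nonneg.2 hgn1)
  have hprod : lh * gt * (mh * gt) < (lm + lh * gn) * (mm + mh * gn) := by
    refine (le_abs_self _).trans_lt ?_
    rw [abs_mul]
    exact mul_lt_mul'' (abs_sub_mul_lt_interpolation hlp hlm ht₁ ht₂)
      (abs_sub_mul_lt_interpolation hmp hmm ht₁ ht₂) (abs_nonneg _) (abs_nonneg _)
  have hmin : (min mp mm) ^ 2 ≤ (mm + mh * gn) ^ 2 :=
    pow_le_pow_left₀ (lt_min hmp hmm).le (min_le_interpolation hgn0 hgn1) 2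
  have hdet : 2 * (min mp mm) ^ 2 < Xi.det := by
    simp only [Xi, Matrix.det_fin_two_of]
    linarith
  refine ⟨hdet, (Matrix.isUnit_iff_isUnit_det Xi).2 (isUnit_iff_ne_zero.2 ?_)⟩
  exact ((by positivity : (0 : ℝ) ≤ 2 * (min mp mm) ^ 2).trans_lt hdet).ne'
end

section
/- Let X, A ∈ ℝ², let t̃ ∈ [0,1], set Y(t) = tA + (1−t)X and Ỹ = Y(t̃). Let u⁻ : U⁻ → ℝ² be twice continuously differentiable on an open set containing {Y(t) : 0 ≤ t ≤ t̃}, and let u⁺ : U⁺ → ℝ² be twice continuously differentiable on an open set containing {Y(t) : t̃ ≤ t ≤ 1}. Assume u⁻(Ỹ) = u⁺(Ỹ) and that M is a 4×4 real matrix satisfying Vec(Du⁺(Ỹ)) = M·Vec(Du⁻(Ỹ)), where Du denotes the 2×2 Jacobian. Then u⁺(A) = u⁻(X) + ((A−X)ᵀ ⊗ I₂)·Vec(Du⁻(X)) + ((A−Ỹ)ᵀ ⊗ I₂)·(M − I₄)·Vec(Du⁻(X)) + R₁ + R₂ + R₃, where R₁ = ∫₀^{t̃} (1−t)·(d²/dt²)[u⁻(Y(t))]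 dt, R₂ = ∫_{t̃}^{1} (1−t)·(d²/dt²)[u⁺(Y(t))] dt, and R₃ = (1−t̃)·((A−X)ᵀ ⊗ I₂)·(M − I₄)·∫₀^{t̃} (d/dt)[Vec(Du⁻(Y(t)))] dt. -/
open Matrix intervalIntegral

noncomputable section

/-- Column-stacking vectorization of a 2×2 matrix: `Vec(G) = (G₁₁, G₂₁, G₁₂, G₂₂)ᵀ`. -/
def Vec2 (G : Matrix (Fin 2) (Fin 2) ℝ) : Fin 4 → ℝ := ![G 0 0, G 1 0, G 0 1, G 1 1]

/-- The 2×4 matrix `rᵀ ⊗ I₂ = [r₁I₂, r₂I₂]`. -/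
def rowKronI (r : Fin 2 → ℝ) : Matrix (Fin 2) (Fin 4) ℝ :=
  !![r 0, 0, r 1, 0;
     0, r 0, 0, r 1]

/-- The 2×2 Jacobian matrix of a planar vector field `u`, whose `i`-th row is `∇uᵢ`. -/
def Jac (u : (Fin 2 → ℝ) → (Fin 2 → ℝ)) (X : Fin 2 → ℝ) : Matrix (Fin 2) (Fin 2) ℝ :=
  Matrix.of fun i j => fderiv ℝ u X (Pi.single j 1) i

/-- Fundamental theorem of calculus for a function that is `C¹` on an open set containing
the interval of integration. -/
lemma integral_deriv_eq_sub_of_contDiffOn {E : Type*} [NormedAddCommGroup E] [NormedSpace ℝ E]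
    [CompleteSpace E] {f : ℝ → E} {S : Set ℝ} (hS : IsOpen S) (hf : ContDiffOn ℝ 1 f S)
    {a b : ℝ} (hab : Set.uIcc a b ⊆ S) : ∫ t in a..b, deriv f t = f b - f a := by
  apply integral_deriv_eq_sub
  · intro t ht
    exact (hf.differentiableOn one_ne_zero).differentiableAt (hS.mem_nhds (hab ht))
  · exact ((hf.continuousOn_deriv_of_isOpen hS le_rfl).mono hab).intervalIntegrable

/-- Integration by parts for the integral remainder of a second-order Taylor expansion. -/
lemma integral_sub_smul_deriv_deriv {E : Type*} [NormedAddCommGroup E] [NormedSpace ℝ E]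
    [CompleteSpace E] {f : ℝ → E} {S : Set ℝ} (hS : IsOpen S) (hf : ContDiffOn ℝ 2 f S)
    {a b : ℝ} (hab : Set.uIcc a b ⊆ S) (c : ℝ) :
    ∫ t in a..b, (c - t) • deriv (deriv f) t
      = ((c - b) • deriv f b + f b) - ((c - a) • deriv f a + f a) := by
  have hf' : ContDiffOn ℝ 1 (deriv f) S := hf.deriv_of_isOpen hS (by norm_num)
  apply integral_eq_sub_of_hasDerivAt (f := fun t => (c - t) • deriv f t + f t)
  · intro t ht
    have hn := hS.mem_nhds (hab ht)
    have h1 := ((hf.differentiableOn two_ne_zero).differentiableAt hn).hasDerivAt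
    have h2 := ((hf'.differentiableOn one_ne_zero).differentiableAt hn).hasDerivAt
    have h := (((hasDerivAt_id t).const_sub c).smul h2).add h1
    rwa [neg_one_smul, neg_add_cancel_right] at h
  · apply ContinuousOn.intervalIntegrable
    exact (by fun_prop : ContinuousOn (fun t : ℝ => c - t) _).smul
      ((hf'.continuousOn_deriv_of_isOpen hS le_rfl).mono hab)

/-- Multiplying the vectorized Jacobian by `rᵀ ⊗ I₂` gives the derivative in direction `r`. -/
lemma rowKronI_mulVec_Vec2_Jac (u : (Fin 2 → ℝ) → (Fin 2 → ℝ)) (X r : Fin 2 → ℝ) :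
    (rowKronI r).mulVec (Vec2 (Jac u X)) = fderiv ℝ u X r := by
  have hr : r = r 0 • Pi.single 0 1 + r 1 • Pi.single 1 1 := by
    ext i; fin_cases i <;> simp
  conv_rhs => rw [hr, map_add, map_smul, map_smul]
  ext i
  fin_cases i <;> simp [rowKronI, Vec2, Jac, Matrix.mulVec, dotProduct, Fin.sum_univ_four]

lemma rowKronI_smul (c : ℝ) (r : Fin 2 → ℝ) : rowKronI (c • r) = c • rowKronI r := by
  ext i j
  fin_cases i <;> fin_cases j <;> simp [rowKronI]

lemma deriv_comp_add_smul {u : (Fin 2 → ℝ) → (Fin 2 → ℝ)} {X v : Fin 2 → ℝ} {t : ℝ}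
    (hu : DifferentiableAt ℝ u (X + t • v)) :
    deriv (fun s : ℝ => u (X + s • v)) t = (rowKronI v).mulVec (Vec2 (Jac u (X + t • v))) := by
  rw [rowKronI_mulVec_Vec2_Jac]
  have h : HasDerivAt (fun s : ℝ => X + s • v) v t := by
    simpa using ((hasDerivAt_id t).smul_const v).const_add X
  exact (hu.hasFDerivAt.comp_hasDerivAt t h).deriv

lemma contDiffOn_Vec2_Jac {u : (Fin 2 → ℝ) → (Fin 2 → ℝ)} {U : Set (Fin 2 → ℝ)}
    (hU : IsOpen U) (hu : ContDiffOn ℝ 2 u U) : ContDiffOn ℝ 1 (fun Y => Vec2 (Jac u Y)) U := by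
  have h : ContDiffOn ℝ 1 (fderiv ℝ u) U := hu.fderiv_of_isOpen hU (by norm_num)
  have hij (i j : Fin 2) : ContDiffOn ℝ 1 (fun Y => Jac u Y i j) U :=
    contDiffOn_pi.1 (h.clm_apply (contDiffOn_const (c := Pi.single j 1))) i
  rw [contDiffOn_pi]
  intro k
  fin_cases k
  exacts [hij 0 0, hij 1 0, hij 0 1, hij 1 1]

/-- the multi-point Taylor expansion across an interface point
`Ỹ = Y(t̃) = t̃A + (1−t̃)X` on the segment from `X` to `A`:
`u⁺(A) = u⁻(X) + ((A−X)ᵀ⊗I₂)·Vec(Du⁻(X)) + ((A−Ỹ)ᵀ⊗I₂)·(M−I₄)·Vec(Du⁻(X)) + R₁+R₂+R₃`. -/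
theorem multipoint_taylor_expansion_across_interface (X A : Fin 2 → ℝ) (ttil : ℝ)
    (httil : ttil ∈ Set.Icc (0:ℝ) 1)
    (Um Up : Set (Fin 2 → ℝ)) (hUm : IsOpen Um) (hUp : IsOpen Up)
    (hsegm : (fun t : ℝ => X + t • (A - X)) '' Set.Icc 0 ttil ⊆ Um)
    (hsegp : (fun t : ℝ => X + t • (A - X)) '' Set.Icc ttil 1 ⊆ Up)
    (um up : (Fin 2 → ℝ) → (Fin 2 → ℝ))
    (hum : ContDiffOn ℝ 2 um Um) (hup : ContDiffOn ℝ 2 up Up)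
    (M : Matrix (Fin 4) (Fin 4) ℝ)
    (hcont : um (X + ttil • (A - X)) = up (X + ttil • (A - X)))
    (hM : Vec2 (Jac up (X + ttil • (A - X)))
            = M.mulVec (Vec2 (Jac um (X + ttil • (A - X))))) :
    up A = um X + (rowKronI (A - X)).mulVec (Vec2 (Jac um X))
      + (rowKronI (A - (X + ttil • (A - X)))).mulVec ((M - 1).mulVec (Vec2 (Jac um X)))
      + (∫ t in (0:ℝ)..ttil, (1 - t) • deriv (deriv (fun s : ℝ => um (X + s • (A - X)))) t)
      + (∫ t in ttil..(1:ℝ), (1 - t) • deriv (deriv (fun s : ℝ => up (X + s • (A - X)))) t)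
      + (1 - ttil) • (rowKronI (A - X)).mulVec ((M - 1).mulVec
          (∫ t in (0:ℝ)..ttil,
            deriv (fun s : ℝ => Vec2 (Jac um (X + s • (A - X)))) t)) := by
  obtain ⟨h0, h1⟩ := httil
  set v := A - X with hv
  have hY : ContDiff ℝ 2 (fun t : ℝ => X + t • v) := by fun_prop
  have hSm : IsOpen ((fun t : ℝ => X + t • v) ⁻¹' Um) := hUm.preimage hY.continuous
  have hSp : IsOpen ((fun t : ℝ => X + t • v) ⁻¹' Up) := hUp.preimage hY.continuous
  have hIm : Set.uIcc 0 ttil ⊆ (fun t : ℝ => X + t • v) ⁻¹' Um := by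
    rw [Set.uIcc_of_le h0]; exact Set.image_subset_iff.1 hsegm
  have hIp : Set.uIcc ttil 1 ⊆ (fun t : ℝ => X + t • v) ⁻¹' Up := by
    rw [Set.uIcc_of_le h1]; exact Set.image_subset_iff.1 hsegp
  have hdm (t : ℝ) (ht : t ∈ Set.uIcc 0 ttil) : DifferentiableAt ℝ um (X + t • v) :=
    (hum.differentiableOn two_ne_zero).differentiableAt (hUm.mem_nhds (hIm ht))
  have hdp (t : ℝ) (ht : t ∈ Set.uIcc ttil 1) : DifferentiableAt ℝ up (X + t • v) :=
    (hup.differentiableOn two_ne_zero).differentiableAt (hUp.mem_nhds (hIp ht))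
  rw [integral_sub_smul_deriv_deriv (f := fun s : ℝ => um (X + s • v)) hSm
      (hum.comp hY.contDiffOn (Set.mapsTo_preimage _ _)) hIm,
    integral_sub_smul_deriv_deriv (f := fun s : ℝ => up (X + s • v)) hSp
      (hup.comp hY.contDiffOn (Set.mapsTo_preimage _ _)) hIp,
    integral_deriv_eq_sub_of_contDiffOn (f := fun s : ℝ => Vec2 (Jac um (X + s • v))) hSm
      ((contDiffOn_Vec2_Jac hUm hum).comp (hY.of_le (by norm_num)).contDiffOn
        (Set.mapsTo_preimage _ _)) hIm,
    deriv_comp_add_smul (hdm 0 Set.left_mem_uIcc),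
    deriv_comp_add_smul (hdm ttil Set.right_mem_uIcc),
    deriv_comp_add_smul (hdp ttil Set.left_mem_uIcc), hM, hcont]
  have hA : X + v = A := by simp [hv]
  have hAY : A - (X + ttil • v) = (1 - ttil) • v := by
    rw [sub_smul, one_smul, ← hA]; abel
  simp only [hA, hAY, rowKronI_smul, zero_smul, add_zero, sub_self, zero_add, sub_zero, one_smul,
    Matrix.sub_mulVec, Matrix.one_mulVec, Matrix.mulVec_sub, Matrix.smul_mulVec, smul_sub]
  abel
end
end

section
/- Let T ⊆ ℝ² and S ⊆ T be Lebesgue measurable sets, let A ∈ ℝ² and h > 0 be such that ‖A − X‖ ≤ h and tA + (1−t)X ∈ T for all X ∈ S and t ∈ [0,1]. Let u be twice continuously differentiable on an open set containing T, with all second partial derivatives in L²(T). For X ∈ S define R(X) = ∫₀¹ (1−t)·(A−X)ᵀ·H(tA + (1−t)X)·(A−X) dt, where H denotes the Hessian matrix of u. Then there is an absolute constant C (independent of T, S, A, h, u) such that (∫_S R(X)² dX)^{1/2} ≤ C·h²·(Σ_{k,l=1}^{2} ‖∂²u/∂x_k∂x_l‖²_{L²(T)})^{1/2}. -/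
open Matrix MeasureTheory intervalIntegral

noncomputable section

/-- The Hessian matrix of a scalar function `u : ℝ² → ℝ`. -/
def Hess (u : (Fin 2 → ℝ) → ℝ) (X : Fin 2 → ℝ) : Matrix (Fin 2) (Fin 2) ℝ :=
  Matrix.of fun k l => fderiv ℝ (fun Y => fderiv ℝ u Y (Pi.single l 1)) X (Pi.single k 1)

/-- Entries of the Hessian of a `C²` function on an open set are continuous there. -/
lemma continuousOn_Hess {U : Set (Fin 2 → ℝ)} {u : (Fin 2 → ℝ) → ℝ} (hU : IsOpen U)
    (hu : ContDiffOn ℝ 2 u U) (k l : Fin 2) : ContinuousOn (fun X => Hess u X k l) U := by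
  have h1 : ContDiffOn ℝ 1 (fderiv ℝ u) U := hu.fderiv_of_isOpen hU (by norm_num)
  have h2 : ContDiffOn ℝ 1 (fun Y => fderiv ℝ u Y (Pi.single l 1)) U :=
    h1.clm_apply contDiffOn_const
  exact (h2.continuousOn_fderiv_of_isOpen hU le_rfl).clm_apply continuousOn_const

/-- The squared Frobenius norm controls a quadratic form. -/
lemma sq_dotProduct_mulVec_le {n : Type*} [Fintype n] (M : Matrix n n ℝ) (v : n → ℝ) :
    (v ⬝ᵥ M *ᵥ v) ^ 2 ≤ (∑ i, v i ^ 2) ^ 2 * ∑ k, ∑ l, M k l ^ 2 := by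
  have h1 : (v ⬝ᵥ M *ᵥ v) ^ 2 ≤ (∑ i, v i ^ 2) * ∑ k, (M *ᵥ v) k ^ 2 :=
    Finset.sum_mul_sq_le_sq_mul_sq _ _ _
  have h2 : ∑ k, (M *ᵥ v) k ^ 2 ≤ ∑ k, (∑ l, M k l ^ 2) * ∑ i, v i ^ 2 :=
    Finset.sum_le_sum fun k _ => Finset.sum_mul_sq_le_sq_mul_sq _ _ _
  rw [← Finset.sum_mul] at h2
  calc _ ≤ _ := h1
    _ ≤ (∑ i, v i ^ 2) * ((∑ k, ∑ l, M k l ^ 2) * ∑ i, v i ^ 2) := by gcongr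
    _ = _ := by ring

/-- Jensen's inequality for the square on the unit interval. -/
lemma sq_intervalIntegral_le {g : ℝ → ℝ} (hg : ContinuousOn g (Set.Icc 0 1)) :
    (∫ t in (0 : ℝ)..1, g t) ^ 2 ≤ ∫ t in (0 : ℝ)..1, g t ^ 2 := by
  have hg1 : IntervalIntegrable g volume 0 1 :=
    hg.intervalIntegrable_of_Icc zero_le_one
  have hg2 : IntervalIntegrable (fun t => g t ^ 2) volume 0 1 :=
    (hg.pow 2).intervalIntegrable_of_Icc zero_le_one
  set m := ∫ t in (0 : ℝ)..1, g t with hm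
  have h0 : 0 ≤ ∫ t in (0 : ℝ)..1, (g t - m) ^ 2 :=
    intervalIntegral.integral_nonneg zero_le_one fun t _ => sq_nonneg _
  have h1 : ∫ t in (0 : ℝ)..1, (g t - m) ^ 2 =
      ∫ t in (0 : ℝ)..1, (g t ^ 2 - (2 * m) * g t + m ^ 2) := by
    congr 1 with t
    ring
  rw [h1, intervalIntegral.integral_add (hg2.sub (hg1.const_mul _)) intervalIntegrable_const,
    intervalIntegral.integral_sub hg2 (hg1.const_mul _), intervalIntegral.integral_const_mul,
    intervalIntegral.integral_const, ← hm] at h0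
  simp only [sub_zero, one_smul] at h0
  nlinarith

/-- Change of variables under the contraction of ratio `1 - t` toward `A`. -/
lemma lintegral_comp_homothety_le {d : ℕ} {S T : Set (Fin d → ℝ)} (hS : MeasurableSet S)
    (hT : MeasurableSet T) {A : Fin d → ℝ} {t : ℝ} (ht : t < 1)
    (hST : ∀ X ∈ S, X + t • (A - X) ∈ T) {f : (Fin d → ℝ) → ENNReal} (hf : Measurable f) :
    ∫⁻ X in S, ENNReal.ofReal ((1 - t) ^ d) * f (X + t • (A - X)) ≤ ∫⁻ X in T, f X := by
  have hr : (0 : ℝ) < (1 - t) ^ d := pow_pos (sub_pos.2 ht) d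
  have hTf : Measurable (T.indicator f) := hf.indicator hT
  have hmap := Measure.map_addHaar_smul (volume : Measure (Fin d → ℝ)) (sub_pos.2 ht).ne'
  have hmeas : Measurable fun X : Fin d → ℝ => f (X + t • (A - X)) :=
    hf.comp (by fun_prop)
  have hpull : ∫⁻ X, T.indicator f ((1 - t) • X + t • A) =
      ENNReal.ofReal ((1 - t) ^ d)⁻¹ * ∫⁻ X in T, f X := by
    rw [← lintegral_map (μ := volume) (f := fun Y => T.indicator f (Y + t • A))
      (g := fun X => (1 - t) • X) (hTf.comp (by fun_prop)) (by fun_prop), hmap,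
      lintegral_smul_measure, lintegral_add_right_eq_self (T.indicator f),
      lintegral_indicator hT, Module.finrank_fin_fun, abs_of_pos (inv_pos.2 hr), smul_eq_mul]
  calc ∫⁻ X in S, ENNReal.ofReal ((1 - t) ^ d) * f (X + t • (A - X))
      = ENNReal.ofReal ((1 - t) ^ d) * ∫⁻ X in S, f (X + t • (A - X)) :=
        lintegral_const_mul _ hmeas
    _ ≤ ENNReal.ofReal ((1 - t) ^ d) * ∫⁻ X in S, T.indicator f ((1 - t) • X + t • A) := by
        refine mul_le_mul' le_rfl ?_
        refine setLIntegral_mono' hS fun X hX => ?_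
        have hXt : (1 - t) • X + t • A = X + t • (A - X) := by module
        rw [hXt, Set.indicator_of_mem (hST X hX)]
    _ ≤ ENNReal.ofReal ((1 - t) ^ d) * ∫⁻ X, T.indicator f ((1 - t) • X + t • A) := by
        gcongr
        exact Measure.restrict_le_self
    _ = ∫⁻ X in T, f X := by
        rw [hpull, ← mul_assoc, ← ENNReal.ofReal_mul hr.le, mul_inv_cancel₀ hr.ne',
          ENNReal.ofReal_one, one_mul]

/-- Pointwise bound of the integral Taylor remainder. -/
lemma sq_taylor_remainder_le {U : Set (Fin 2 → ℝ)} {u : (Fin 2 → ℝ) → ℝ} (hU : IsOpen U)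
    (hu : ContDiffOn ℝ 2 u U) {A X : Fin 2 → ℝ} {h : ℝ} (hh : 0 ≤ h)
    (hX : Real.sqrt (∑ i, (A i - X i) ^ 2) ≤ h)
    (hseg : ∀ t ∈ Set.Icc (0 : ℝ) 1, X + t • (A - X) ∈ U) :
    ENNReal.ofReal ((∫ t in (0 : ℝ)..1,
        (1 - t) * ((A - X) ⬝ᵥ (Hess u (X + t • (A - X))).mulVec (A - X))) ^ 2) ≤
      ∫⁻ t in Set.Ioo (0 : ℝ) 1, ENNReal.ofReal (h ^ 4) * (ENNReal.ofReal ((1 - t) ^ 2) *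
        ENNReal.ofReal (∑ k, ∑ l, Hess u (X + t • (A - X)) k l ^ 2)) := by
  have hcont : ∀ k l, ContinuousOn (fun t : ℝ => Hess u (X + t • (A - X)) k l) (Set.Icc 0 1) :=
    fun k l => (continuousOn_Hess hU hu k l).comp (by fun_prop) hseg
  have hg : ContinuousOn (fun t : ℝ =>
      (1 - t) * ((A - X) ⬝ᵥ (Hess u (X + t • (A - X))).mulVec (A - X))) (Set.Icc 0 1) := by
    simp only [dotProduct, mulVec]
    fun_prop
  have hd : (∑ i, (A - X) i ^ 2) ^ 2 ≤ h ^ 4 := by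
    have h1 : ∑ i, (A i - X i) ^ 2 ≤ h ^ 2 := (Real.sqrt_le_left hh).1 hX
    calc (∑ i, (A - X) i ^ 2) ^ 2 ≤ (h ^ 2) ^ 2 := by
          simp only [Pi.sub_apply]
          gcongr
      _ = h ^ 4 := by ring
  refine (ENNReal.ofReal_le_ofReal (sq_intervalIntegral_le hg)).trans ?_
  have hgint : IntegrableOn (fun t : ℝ =>
      ((1 - t) * ((A - X) ⬝ᵥ (Hess u (X + t • (A - X))).mulVec (A - X))) ^ 2) (Set.Ioo 0 1) :=
    (hg.pow 2).integrableOn_Icc.mono_set Set.Ioo_subset_Icc_self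
  rw [intervalIntegral.integral_of_le zero_le_one, integral_Ioc_eq_integral_Ioo,
    ofReal_integral_eq_lintegral_ofReal hgint
      (ae_of_all _ fun t => sq_nonneg _)]
  refine lintegral_mono fun t => ?_
  rw [← ENNReal.ofReal_mul (by positivity), ← ENNReal.ofReal_mul (by positivity)]
  refine ENNReal.ofReal_le_ofReal ?_
  calc _ = (1 - t) ^ 2 * ((A - X) ⬝ᵥ (Hess u (X + t • (A - X))).mulVec (A - X)) ^ 2 :=
        mul_pow _ _ _
    _ ≤ (1 - t) ^ 2 * (h ^ 4 * ∑ k, ∑ l, Hess u (X + t • (A - X)) k l ^ 2) := by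
        gcongr
        refine (sq_dotProduct_mulVec_le _ _).trans ?_
        gcongr
    _ = _ := by ring

/-- there is an absolute constant `C` such that for any measurable `S ⊆ T`,
point `A` with `‖A − X‖ ≤ h` and `tA + (1−t)X ∈ T` for all `X ∈ S`, `t ∈ [0,1]`, and any `u`
which is `C²` on an open set containing `T` with second partials in `L²(T)`, the integral
Taylor remainder `R(X) = ∫₀¹ (1−t)(A−X)ᵀH(tA+(1−t)X)(A−X) dt` satisfies
`‖R‖_{L²(S)} ≤ C h² (Σ_{k,l} ‖∂²u/∂x_k∂x_l‖²_{L²(T)})^{1/2}`. -/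
theorem taylor_remainder_L2_estimate :
    ∃ C : ℝ, 0 < C ∧
      ∀ (T S : Set (Fin 2 → ℝ)), MeasurableSet T → MeasurableSet S → S ⊆ T →
      ∀ (A : Fin 2 → ℝ) (h : ℝ), 0 < h →
      (∀ X ∈ S, Real.sqrt (∑ i, (A i - X i)^2) ≤ h) →
      (∀ X ∈ S, ∀ t ∈ Set.Icc (0:ℝ) 1, X + t • (A - X) ∈ T) →
      ∀ (U : Set (Fin 2 → ℝ)) (u : (Fin 2 → ℝ) → ℝ),
        IsOpen U → T ⊆ U → ContDiffOn ℝ 2 u U →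
        (∀ k l : Fin 2, IntegrableOn (fun X => (Hess u X k l)^2) T volume) →
        Real.sqrt (∫ X in S, (∫ t in (0:ℝ)..1,
            (1 - t) * ((A - X) ⬝ᵥ (Hess u (X + t • (A - X))).mulVec (A - X)))^2)
          ≤ C * h^2 * Real.sqrt (∑ k, ∑ l, ∫ X in T, (Hess u X k l)^2) := by
  refine ⟨1, one_pos, ?_⟩
  intro T S hT hS hST A h hh hdist hseg U u hU hTU hu hint
  set F : (Fin 2 → ℝ) → ℝ := fun X => ∑ k, ∑ l, Hess u X k l ^ 2 with hF
  have hF0 : ∀ X, 0 ≤ F X := fun X => by positivity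
  have hFc : ContinuousOn F U := by
    have := fun k l => continuousOn_Hess hU hu k l
    fun_prop
  have hFint : IntegrableOn F T :=
    integrable_finsetSum _ fun k _ => integrable_finsetSum _ fun l _ => hint k l
  have hsum : ∑ k, ∑ l, ∫ X in T, (Hess u X k l) ^ 2 = ∫ X in T, F X := by
    rw [integral_finsetSum _ fun k _ => integrable_finsetSum _ fun l _ => hint k l]
    exact Finset.sum_congr rfl fun k _ => (integral_finsetSum _ fun l _ => hint k l).symm
  have hI0 : 0 ≤ ∫ X in T, F X := integral_nonneg hF0
  -- extending by zero outside `U` gives a globally measurable density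
  set G : (Fin 2 → ℝ) → ENNReal := fun X => ENNReal.ofReal (U.indicator F X) with hG
  have hGm : Measurable G := by
    refine ENNReal.measurable_ofReal.comp ?_
    classical
    rw [← Set.piecewise_eq_indicator]
    exact hFc.measurable_piecewise continuousOn_const hU.measurableSet
  have hGU : ∀ X ∈ U, G X = ENNReal.ofReal (F X) := fun X hX => by
    simp only [hG, Set.indicator_of_mem hX]
  have key : ∫⁻ X in S, ENNReal.ofReal ((∫ t in (0 : ℝ)..1,
        (1 - t) * ((A - X) ⬝ᵥ (Hess u (X + t • (A - X))).mulVec (A - X))) ^ 2) ≤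
      ENNReal.ofReal (h ^ 4 * ∫ X in T, F X) := by
    calc _ ≤ ∫⁻ X in S, ∫⁻ t in Set.Ioo (0 : ℝ) 1, ENNReal.ofReal (h ^ 4) *
            (ENNReal.ofReal ((1 - t) ^ 2) * G (X + t • (A - X))) := by
          refine setLIntegral_mono' hS fun X hX => ?_
          refine (sq_taylor_remainder_le hU hu hh.le (hdist X hX)
            fun t ht => hTU (hseg X hX t ht)).trans ?_
          refine setLIntegral_mono' measurableSet_Ioo fun t ht => ?_
          rw [hGU _ (hTU (hseg X hX t (Set.Ioo_subset_Icc_self ht)))]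
      _ = ∫⁻ t in Set.Ioo (0 : ℝ) 1, ∫⁻ X in S, ENNReal.ofReal (h ^ 4) *
            (ENNReal.ofReal ((1 - t) ^ 2) * G (X + t • (A - X))) := by
          refine lintegral_lintegral_swap (Measurable.aemeasurable ?_)
          have hGc : Measurable fun p : (Fin 2 → ℝ) × ℝ => G (p.1 + p.2 • (A - p.1)) :=
            hGm.comp (by fun_prop)
          simp only [Function.uncurry_def]
          fun_prop
      _ ≤ ∫⁻ _ in Set.Ioo (0 : ℝ) 1, ENNReal.ofReal (h ^ 4) * ∫⁻ X in T, G X := by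
          refine setLIntegral_mono' measurableSet_Ioo fun t ht => ?_
          rw [lintegral_const_mul' _ _ ENNReal.ofReal_ne_top]
          refine mul_le_mul' le_rfl ?_
          exact lintegral_comp_homothety_le hS hT ht.2
            (fun X hX => hseg X hX t (Set.Ioo_subset_Icc_self ht)) hGm
      _ = ENNReal.ofReal (h ^ 4 * ∫ X in T, F X) := by
          rw [setLIntegral_const, Real.volume_Ioo, sub_zero, ENNReal.ofReal_one, mul_one,
            setLIntegral_congr_fun hT fun X hX => hGU X (hTU hX),
            ENNReal.ofReal_mul (by positivity),
            ofReal_integral_eq_lintegral_ofReal hFint (ae_of_all _ hF0)]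
  have hle : ∫ X in S, (∫ t in (0 : ℝ)..1,
        (1 - t) * ((A - X) ⬝ᵥ (Hess u (X + t • (A - X))).mulVec (A - X))) ^ 2 ≤
      h ^ 4 * ∫ X in T, F X := by
    by_cases hR : IntegrableOn (fun X => (∫ t in (0 : ℝ)..1,
        (1 - t) * ((A - X) ⬝ᵥ (Hess u (X + t • (A - X))).mulVec (A - X))) ^ 2) S
    · rw [← ofReal_integral_eq_lintegral_ofReal hR (ae_of_all _ fun X => sq_nonneg _)] at key
      exact (ENNReal.ofReal_le_ofReal_iff (by positivity)).1 key
    · rw [integral_undef hR]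
      positivity
  rw [hsum, one_mul]
  calc _ ≤ Real.sqrt (h ^ 4 * ∫ X in T, F X) := Real.sqrt_le_sqrt hle
    _ = h ^ 2 * Real.sqrt (∫ X in T, F X) := by
        rw [show h ^ 4 = (h ^ 2) ^ 2 by ring, Real.sqrt_mul (by positivity),
          Real.sqrt_sq (by positivity)]
end
end

section
/- Let T ⊆ ℝ² and S ⊆ T be Lebesgue measurable sets, let A ∈ ℝ² and h > 0 be such that ‖A − X‖ ≤ h and tA + (1−t)X ∈ T for all X ∈ S and t ∈ [0,1]. Let t̃ : S → [0,1] and M : S → M₄(ℝ) be measurable maps with ‖M(X) − I₄‖ ≤ C₀ for all X ∈ S, where ‖·‖ is the operator norm and C₀ > 0 a constant. Let u = (u₁,u₂) be twice continuously differentiable on an open set containing T with all second partial derivatives in L²(T), and for X ∈ S define R₃(X) = (1 − t̃(X))·((A−X)ᵀ ⊗ I₂)·(M(X) − I₄)·∫₀^{t̃(X)} (d/dt)[Vec(Du(tA + (1−t)X))] dt, where Du is the 2×2 Jacobian of u. Then there is an absolute constant C such that (∫_S ‖R₃(X)‖² dX)^{1/2} ≤ C·C₀·h²·(Σ_{j=1}^{2}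 Σ_{k,l=1}^{2} ‖∂²u_j/∂x_k∂x_l‖²_{L²(T)})^{1/2}. -/
open Matrix MeasureTheory intervalIntegral

noncomputable section

/-- Euclidean norm on `ℝ²`. -/
def norm2v (v : Fin 2 → ℝ) : ℝ := Real.sqrt (∑ i, (v i)^2)

/-- Euclidean norm on `ℝ⁴`. -/
def norm4v (v : Fin 4 → ℝ) : ℝ := Real.sqrt (∑ i, (v i)^2)

theorem norm2v_sq (v : Fin 2 → ℝ) : norm2v v ^ 2 = ∑ i, v i ^ 2 :=
  Real.sq_sqrt (Finset.sum_nonneg fun _ _ => sq_nonneg _)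

theorem norm4v_sq (v : Fin 4 → ℝ) : norm4v v ^ 2 = ∑ i, v i ^ 2 :=
  Real.sq_sqrt (Finset.sum_nonneg fun _ _ => sq_nonneg _)

theorem norm2v_rowKronI_mulVec_sq_le (r : Fin 2 → ℝ) (w : Fin 4 → ℝ) :
    norm2v ((rowKronI r).mulVec w) ^ 2 ≤ (∑ i, r i ^ 2) * norm4v w ^ 2 := by
  rw [norm2v_sq, norm4v_sq]
  simp only [rowKronI, mulVec, dotProduct, Fin.sum_univ_four, Fin.sum_univ_two, of_apply,
    cons_val', cons_val_zero, cons_val_one, cons_val, zero_mul, add_zero, zero_add]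
  nlinarith [sq_nonneg (r 0 * w 2 - r 1 * w 0), sq_nonneg (r 0 * w 3 - r 1 * w 1)]

theorem sq_intervalIntegral_le_s14 {f : ℝ → ℝ} {τ : ℝ} (hτ : 0 ≤ τ)
    (hf : ContinuousOn f (Set.Icc 0 τ)) :
    (∫ t in (0 : ℝ)..τ, f t) ^ 2 ≤ τ * ∫ t in (0 : ℝ)..τ, f t ^ 2 := by
  rcases hτ.eq_or_lt with rfl | hτ'
  · simp
  have hi : IntervalIntegrable f volume 0 τ := hf.intervalIntegrable_of_Icc hτ
  have hi2 : IntervalIntegrable (fun t => f t ^ 2) volume 0 τ :=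
    (hf.pow 2).intervalIntegrable_of_Icc hτ
  set m := ∫ t in (0 : ℝ)..τ, f t with hm
  have key : 0 ≤ ∫ t in (0 : ℝ)..τ, (τ * f t - m) ^ 2 :=
    intervalIntegral.integral_nonneg hτ fun _ _ => sq_nonneg _
  have expand : ∫ t in (0 : ℝ)..τ, (τ * f t - m) ^ 2
      = τ ^ 2 * (∫ t in (0 : ℝ)..τ, f t ^ 2) - 2 * τ * m * m + τ * m ^ 2 := by
    have : ∀ t, (τ * f t - m) ^ 2 = τ ^ 2 * f t ^ 2 - 2 * τ * m * f t + m ^ 2 := fun t => by ring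
    simp only [this]
    rw [intervalIntegral.integral_add ((hi2.const_mul _).sub (hi.const_mul _))
        intervalIntegrable_const,
      intervalIntegral.integral_sub (hi2.const_mul _) (hi.const_mul _),
      intervalIntegral.integral_const_mul, intervalIntegral.integral_const_mul,
      intervalIntegral.integral_const]
    rw [← hm, smul_eq_mul, sub_zero]
  rw [expand] at key
  have : 0 ≤ τ * (τ * (∫ t in (0 : ℝ)..τ, f t ^ 2) - m ^ 2) := by linarith
  linarith [nonneg_of_mul_nonneg_right this hτ']

theorem norm4v_intervalIntegral_sq_le {g : ℝ → Fin 4 → ℝ} {τ : ℝ} (hτ : 0 ≤ τ)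
    (hg : ContinuousOn g (Set.Icc 0 τ)) :
    norm4v (∫ t in (0 : ℝ)..τ, g t) ^ 2 ≤ τ * ∫ t in (0 : ℝ)..τ, norm4v (g t) ^ 2 := by
  have hgi : ∀ i, ContinuousOn (fun t => g t i) (Set.Icc 0 τ) := fun i =>
    (continuous_apply i).comp_continuousOn hg
  have happ : ∀ i, (∫ t in (0 : ℝ)..τ, g t) i = ∫ t in (0 : ℝ)..τ, g t i := fun i =>
    ((ContinuousLinearMap.proj (R := ℝ) (φ := fun _ : Fin 4 => ℝ) i).intervalIntegral_comp_comm
      (hg.intervalIntegrable_of_Icc hτ)).symm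
  simp only [norm4v_sq]
  rw [intervalIntegral.integral_finsetSum (f := fun i t => g t i ^ 2) fun i _ =>
    ((hgi i).pow 2).intervalIntegrable_of_Icc hτ, Finset.mul_sum]
  refine Finset.sum_le_sum fun i _ => ?_
  rw [happ]
  exact sq_intervalIntegral_le_s14 hτ (hgi i)

/-- The sum of the squares of all second partial derivatives of a planar vector field. -/
def hessSq (u : (Fin 2 → ℝ) → (Fin 2 → ℝ)) (X : Fin 2 → ℝ) : ℝ :=
  ∑ j, ∑ k, ∑ l, Hess (fun Y => u Y j) X k l ^ 2

theorem hessSq_nonneg (u : (Fin 2 → ℝ) → (Fin 2 → ℝ)) (X : Fin 2 → ℝ) : 0 ≤ hessSq u X := by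
  unfold hessSq; positivity

section Smooth

variable {U : Set (Fin 2 → ℝ)} {u : (Fin 2 → ℝ) → (Fin 2 → ℝ)}

theorem differentiableAt_fderiv_of_contDiffOn_two (hU : IsOpen U) (hu : ContDiffOn ℝ 2 u U)
    {X : Fin 2 → ℝ} (hX : X ∈ U) : DifferentiableAt ℝ (fderiv ℝ u) X :=
  ((hu.fderiv_of_isOpen (m := 1) hU (by norm_num)).differentiableOn (by norm_num)).differentiableAt
    (hU.mem_nhds hX)

theorem continuousOn_fderiv_fderiv (hU : IsOpen U) (hu : ContDiffOn ℝ 2 u U) :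
    ContinuousOn (fderiv ℝ (fderiv ℝ u)) U :=
  (hu.fderiv_of_isOpen (m := 1) hU (by norm_num)).continuousOn_fderiv_of_isOpen hU le_rfl

theorem hess_eq_fderiv_fderiv (hU : IsOpen U) (hu : ContDiffOn ℝ 2 u U)
    {X : Fin 2 → ℝ} (hX : X ∈ U) (j k l : Fin 2) :
    Hess (fun Y => u Y j) X k l
      = fderiv ℝ (fderiv ℝ u) X (Pi.single k 1) (Pi.single l 1) j := by
  have hev : (fun Y => fderiv ℝ (fun Z => u Z j) Y (Pi.single l 1))
      =ᶠ[nhds X] fun Y => fderiv ℝ u Y (Pi.single l 1) j := by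
    filter_upwards [hU.mem_nhds hX] with Y hY
    have hd : DifferentiableAt ℝ u Y :=
      (hu.differentiableOn (by norm_num)).differentiableAt (hU.mem_nhds hY)
    rw [fderiv_apply hd j]
    rfl
  have hd2 := (differentiableAt_fderiv_of_contDiffOn_two hU hu hX).hasFDerivAt
  have hd3 := hasFDerivAt_pi'.1 (hd2.clm_apply (hasFDerivAt_const (Pi.single l (1 : ℝ)) X)) j
  simp only [Hess, of_apply]
  rw [hev.fderiv_eq, hd3.fderiv]
  simp

theorem continuousOn_hessSq (hU : IsOpen U) (hu : ContDiffOn ℝ 2 u U) :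
    ContinuousOn (hessSq u) U := by
  refine continuousOn_finsetSum _ fun j _ => continuousOn_finsetSum _ fun k _ =>
    continuousOn_finsetSum _ fun l _ => ContinuousOn.pow ?_ 2
  refine ContinuousOn.congr ?_ fun X hX => hess_eq_fderiv_fderiv hU hu hX j k l
  exact (continuous_apply j).comp_continuousOn
    (((continuousOn_fderiv_fderiv hU hu).clm_apply continuousOn_const).clm_apply continuousOn_const)

/-- The derivative of `Vec (Du)` at `X` in the direction `r`. -/
def vecJacDeriv (u : (Fin 2 → ℝ) → (Fin 2 → ℝ)) (r X : Fin 2 → ℝ) : Fin 4 → ℝ :=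
  Vec2 (Matrix.of fun i j => fderiv ℝ (fderiv ℝ u) X r (Pi.single j 1) i)

theorem hasDerivAt_vec2_jac_segment (hU : IsOpen U) (hu : ContDiffOn ℝ 2 u U)
    {X r : Fin 2 → ℝ} {t : ℝ} (ht : X + t • r ∈ U) :
    HasDerivAt (fun s : ℝ => Vec2 (Jac u (X + s • r))) (vecJacDeriv u r (X + t • r)) t := by
  have hline : HasDerivAt (fun s : ℝ => X + s • r) r t := by
    simpa using ((hasDerivAt_id t).smul_const r).const_add X
  have hD : HasDerivAt (fun s : ℝ => fderiv ℝ u (X + s • r))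
      (fderiv ℝ (fderiv ℝ u) (X + t • r) r) t :=
    (differentiableAt_fderiv_of_contDiffOn_two hU hu ht).hasFDerivAt.comp_hasDerivAt t hline
  have hentry : ∀ i j : Fin 2, HasDerivAt (fun s : ℝ => Jac u (X + s • r) i j)
      (fderiv ℝ (fderiv ℝ u) (X + t • r) r (Pi.single j 1) i) t := fun i j => by
    simpa [Jac] using hasDerivAt_pi.1 (hD.clm_apply (hasDerivAt_const t (Pi.single j (1 : ℝ)))) i
  refine hasDerivAt_pi.2 fun i => ?_
  fin_cases i <;> exact hentry _ _

theorem continuousOn_vecJacDeriv (hU : IsOpen U) (hu : ContDiffOn ℝ 2 u U) (r : Fin 2 → ℝ) :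
    ContinuousOn (vecJacDeriv u r) U := by
  have hentry : ∀ i j : Fin 2, ContinuousOn
      (fun X => fderiv ℝ (fderiv ℝ u) X r (Pi.single j 1) i) U := fun i j =>
    (continuous_apply i).comp_continuousOn
      (((continuousOn_fderiv_fderiv hU hu).clm_apply continuousOn_const).clm_apply
        continuousOn_const)
  refine continuousOn_pi.2 fun i => ?_
  fin_cases i <;> exact hentry _ _

theorem norm4v_vecJacDeriv_sq_le (hU : IsOpen U) (hu : ContDiffOn ℝ 2 u U)
    {X : Fin 2 → ℝ} (hX : X ∈ U) (r : Fin 2 → ℝ) :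
    norm4v (vecJacDeriv u r X) ^ 2 ≤ (∑ i, r i ^ 2) * hessSq u X := by
  have hr : r = r 0 • Pi.single 0 1 + r 1 • Pi.single 1 1 := by
    ext i; fin_cases i <;> simp
  have hexp : ∀ i j : Fin 2, fderiv ℝ (fderiv ℝ u) X r (Pi.single j 1) i
      = r 0 * Hess (fun Y => u Y i) X 0 j + r 1 * Hess (fun Y => u Y i) X 1 j := fun i j => by
    rw [hess_eq_fderiv_fderiv hU hu hX, hess_eq_fderiv_fderiv hU hu hX]
    conv_lhs => rw [hr]
    simp
  have cs : ∀ a b : ℝ, (r 0 * a + r 1 * b) ^ 2 ≤ (r 0 ^ 2 + r 1 ^ 2) * (a ^ 2 + b ^ 2) :=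
    fun a b => by nlinarith [sq_nonneg (r 0 * b - r 1 * a)]
  rw [norm4v_sq, hessSq]
  simp only [vecJacDeriv, Vec2, Fin.sum_univ_four, Fin.sum_univ_two, of_apply, hexp, cons_val_zero,
    cons_val_one, cons_val]
  linarith [cs (Hess (fun Y => u Y 0) X 0 0) (Hess (fun Y => u Y 0) X 1 0),
    cs (Hess (fun Y => u Y 1) X 0 0) (Hess (fun Y => u Y 1) X 1 0),
    cs (Hess (fun Y => u Y 0) X 0 1) (Hess (fun Y => u Y 0) X 1 1),
    cs (Hess (fun Y => u Y 1) X 0 1) (Hess (fun Y => u Y 1) X 1 1)]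

theorem norm4v_integral_deriv_vec2_jac_sq_le (hU : IsOpen U) (hu : ContDiffOn ℝ 2 u U)
    {X r : Fin 2 → ℝ} {τ : ℝ} (hτ : τ ∈ Set.Icc (0 : ℝ) 1)
    (hseg : ∀ t ∈ Set.Icc (0 : ℝ) τ, X + t • r ∈ U) :
    norm4v (∫ t in (0 : ℝ)..τ, deriv (fun s : ℝ => Vec2 (Jac u (X + s • r))) t) ^ 2
      ≤ (∑ i, r i ^ 2) * ∫ t in (0 : ℝ)..τ, hessSq u (X + t • r) := by
  have hline : ContinuousOn (fun t : ℝ => X + t • r) (Set.Icc 0 τ) := by fun_prop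
  have hg : ContinuousOn (fun t : ℝ => vecJacDeriv u r (X + t • r)) (Set.Icc 0 τ) :=
    (continuousOn_vecJacDeriv hU hu r).comp hline hseg
  have hQ : ContinuousOn (fun t : ℝ => hessSq u (X + t • r)) (Set.Icc 0 τ) :=
    (continuousOn_hessSq hU hu).comp hline hseg
  have hN : ContinuousOn (fun t : ℝ => norm4v (vecJacDeriv u r (X + t • r)) ^ 2)
      (Set.Icc 0 τ) := by
    simp only [norm4v_sq]
    exact continuousOn_finsetSum _ fun i _ => ((continuous_apply i).comp_continuousOn hg).pow 2
  have hcongr : ∫ t in (0 : ℝ)..τ, deriv (fun s : ℝ => Vec2 (Jac u (X + s • r))) t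
      = ∫ t in (0 : ℝ)..τ, vecJacDeriv u r (X + t • r) := by
    refine intervalIntegral.integral_congr fun t ht => ?_
    rw [Set.uIcc_of_le hτ.1] at ht
    exact (hasDerivAt_vec2_jac_segment hU hu (hseg t ht)).deriv
  rw [hcongr]
  calc _ ≤ τ * ∫ t in (0 : ℝ)..τ, norm4v (vecJacDeriv u r (X + t • r)) ^ 2 :=
        norm4v_intervalIntegral_sq_le hτ.1 hg
    _ ≤ 1 * ∫ t in (0 : ℝ)..τ, norm4v (vecJacDeriv u r (X + t • r)) ^ 2 := by
        gcongr
        · exact intervalIntegral.integral_nonneg hτ.1 fun _ _ => sq_nonneg _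
        · exact hτ.2
    _ ≤ ∫ t in (0 : ℝ)..τ, (∑ i, r i ^ 2) * hessSq u (X + t • r) := by
        rw [one_mul]
        exact intervalIntegral.integral_mono_on hτ.1 (hN.intervalIntegrable_of_Icc hτ.1)
          ((hQ.const_smul (∑ i, r i ^ 2)).intervalIntegrable_of_Icc hτ.1)
          fun t ht => norm4v_vecJacDeriv_sq_le hU hu (hseg t ht) r
    _ = _ := intervalIntegral.integral_const_mul _ _

theorem norm2v_remainder_sq_le (hU : IsOpen U) (hu : ContDiffOn ℝ 2 u U)
    {X r : Fin 2 → ℝ} {τ h C0 : ℝ} (hτ : τ ∈ Set.Icc (0 : ℝ) 1) (hr : ∑ i, r i ^ 2 ≤ h ^ 2)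
    (hseg : ∀ t ∈ Set.Icc (0 : ℝ) τ, X + t • r ∈ U) {N : Matrix (Fin 4) (Fin 4) ℝ}
    (hN : ∀ v : Fin 4 → ℝ, norm4v (N.mulVec v) ≤ C0 * norm4v v) :
    norm2v ((1 - τ) • (rowKronI r).mulVec (N.mulVec
        (∫ t in (0 : ℝ)..τ, deriv (fun s : ℝ => Vec2 (Jac u (X + s • r))) t))) ^ 2
      ≤ (C0 * h ^ 2) ^ 2 * ((1 - τ) ^ 2 * ∫ t in (0 : ℝ)..τ, hessSq u (X + t • r)) := by
  set w := ∫ t in (0 : ℝ)..τ, deriv (fun s : ℝ => Vec2 (Jac u (X + s • r))) t with hw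
  have hI : 0 ≤ ∫ t in (0 : ℝ)..τ, hessSq u (X + t • r) :=
    intervalIntegral.integral_nonneg hτ.1 fun _ _ => hessSq_nonneg _ _
  have hsmul : ∀ v : Fin 2 → ℝ, norm2v ((1 - τ) • v) ^ 2 = (1 - τ) ^ 2 * norm2v v ^ 2 := by
    intro v
    simp only [norm2v_sq, Pi.smul_apply, smul_eq_mul, mul_pow, Finset.mul_sum]
  have hNw : norm4v (N.mulVec w) ^ 2 ≤ C0 ^ 2 * norm4v w ^ 2 := by
    rw [← mul_pow]
    exact pow_le_pow_left₀ (Real.sqrt_nonneg _) (hN w) 2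
  calc _ = (1 - τ) ^ 2 * norm2v ((rowKronI r).mulVec (N.mulVec w)) ^ 2 := hsmul _
    _ ≤ (1 - τ) ^ 2 * ((∑ i, r i ^ 2) * norm4v (N.mulVec w) ^ 2) := by
        gcongr; exact norm2v_rowKronI_mulVec_sq_le _ _
    _ ≤ (1 - τ) ^ 2 * (h ^ 2 * (C0 ^ 2 *
          (h ^ 2 * ∫ t in (0 : ℝ)..τ, hessSq u (X + t • r)))) := by
        have h1 : norm4v w ^ 2 ≤ h ^ 2 * ∫ t in (0 : ℝ)..τ, hessSq u (X + t • r) :=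
          (norm4v_integral_deriv_vec2_jac_sq_le hU hu hτ hseg).trans (by gcongr)
        have h2 := hNw.trans (mul_le_mul_of_nonneg_left h1 (sq_nonneg C0))
        gcongr
    _ = _ := by ring

end Smooth

theorem sq_mul_lintegral_comp_segment_le {f : (Fin 2 → ℝ) → ENNReal} (hf : Measurable f)
    (A : Fin 2 → ℝ) {t : ℝ} (ht : t ≤ 1) :
    ENNReal.ofReal ((1 - t) ^ 2) * ∫⁻ X, f (X + t • (A - X)) ≤ ∫⁻ X, f X := by
  rcases ht.eq_or_lt with rfl | ht'
  · simp
  have hne : 1 - t ≠ 0 := by linarith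
  have hpos : 0 < (1 - t) ^ 2 := by positivity
  have heq : ∀ X : Fin 2 → ℝ, X + t • (A - X) = (1 - t) • X + t • A := fun X => by module
  have hmap := Measure.map_addHaar_smul (volume : Measure (Fin 2 → ℝ)) hne
  have hcomp : ∫⁻ X, f ((1 - t) • X + t • A)
      = ENNReal.ofReal |((1 - t) ^ 2)⁻¹| * ∫⁻ X, f X := by
    rw [← lintegral_map (f := fun Y => f (Y + t • A)) (g := fun X : Fin 2 → ℝ => (1 - t) • X)
        (by fun_prop) (by fun_prop), hmap,
      lintegral_smul_measure, lintegral_add_right_eq_self f (t • A)]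
    simp
  simp only [heq]
  rw [hcomp, ← mul_assoc, ← ENNReal.ofReal_mul hpos.le, abs_of_pos (by positivity),
    mul_inv_cancel₀ hpos.ne']
  simp

theorem lintegral_lintegral_comp_segment_le {f : (Fin 2 → ℝ) → ENNReal} (hf : Measurable f)
    (S : Set (Fin 2 → ℝ)) (A : Fin 2 → ℝ) :
    ∫⁻ X in S, ∫⁻ t in Set.Ioc (0 : ℝ) 1, ENNReal.ofReal ((1 - t) ^ 2) * f (X + t • (A - X))
      ≤ ∫⁻ X, f X := by
  rw [lintegral_lintegral_swap (by fun_prop)]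
  calc _ ≤ ∫⁻ _ in Set.Ioc (0 : ℝ) 1, ∫⁻ X, f X := by
        refine setLIntegral_mono measurable_const fun t ht => ?_
        refine (setLIntegral_le_lintegral _ _).trans ?_
        rw [lintegral_const_mul _ (by fun_prop)]
        exact sq_mul_lintegral_comp_segment_le hf A ht.2
    _ = _ := by simp

theorem ofReal_sq_mul_intervalIntegral_le {q : ℝ → ℝ} {τ : ℝ} (hτ : τ ∈ Set.Icc (0 : ℝ) 1)
    (hq : ContinuousOn q (Set.Icc 0 τ)) (hq0 : ∀ t, 0 ≤ q t) {f : ℝ → ENNReal}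
    (hf : ∀ t ∈ Set.Icc (0 : ℝ) τ, ENNReal.ofReal (q t) ≤ f t) :
    ENNReal.ofReal ((1 - τ) ^ 2 * ∫ t in (0 : ℝ)..τ, q t)
      ≤ ∫⁻ t in Set.Ioc (0 : ℝ) 1, ENNReal.ofReal ((1 - t) ^ 2) * f t := by
  have hint : IntegrableOn q (Set.Ioc 0 τ) :=
    (intervalIntegrable_iff_integrableOn_Ioc_of_le hτ.1).1 (hq.intervalIntegrable_of_Icc hτ.1)
  rw [intervalIntegral.integral_of_le hτ.1, ENNReal.ofReal_mul (sq_nonneg _),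
    ofReal_integral_eq_lintegral_ofReal hint (ae_of_all _ hq0),
    ← lintegral_const_mul' _ _ ENNReal.ofReal_ne_top]
  refine le_trans (setLIntegral_mono' measurableSet_Ioc fun t ht => ?_)
    (lintegral_mono_set (Set.Ioc_subset_Ioc_right hτ.2))
  refine mul_le_mul' (ENNReal.ofReal_le_ofReal ?_) (hf t ⟨ht.1.le, ht.2⟩)
  exact pow_le_pow_left₀ (by linarith [hτ.2]) (by linarith [ht.2]) 2

theorem integral_le_of_lintegral_le {α : Type*} [MeasurableSpace α] {μ : Measure α} {f : α → ℝ}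
    {b : ℝ} (hf : 0 ≤ᵐ[μ] f) (hb : 0 ≤ b) (h : ∫⁻ x, ENNReal.ofReal (f x) ∂μ ≤ ENNReal.ofReal b) :
    ∫ x, f x ∂μ ≤ b := by
  by_cases hi : Integrable f μ
  · rwa [← ENNReal.ofReal_le_ofReal_iff hb, ofReal_integral_eq_lintegral_ofReal hi hf]
  · rwa [integral_undef hi]

/-- there is an absolute constant `C` such that the third remainder
`R₃(X) = (1−t̃(X))((A−X)ᵀ⊗I₂)(M(X)−I₄)∫₀^{t̃(X)} (d/dt)Vec(Du(tA+(1−t)X)) dt` of the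
multi-point Taylor expansion satisfies
`‖R₃‖_{L²(S)} ≤ C·C₀·h²·(Σ_{j,k,l} ‖∂²u_j/∂x_k∂x_l‖²_{L²(T)})^{1/2}`, provided
`‖M(X) − I₄‖ ≤ C₀` in the operator norm on `S`. -/
theorem third_remainder_L2_estimate :
    ∃ C : ℝ, 0 < C ∧
      ∀ (T S : Set (Fin 2 → ℝ)), MeasurableSet T → MeasurableSet S → S ⊆ T →
      ∀ (A : Fin 2 → ℝ) (h : ℝ), 0 < h →
      (∀ X ∈ S, Real.sqrt (∑ i, (A i - X i)^2) ≤ h) →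
      (∀ X ∈ S, ∀ t ∈ Set.Icc (0:ℝ) 1, X + t • (A - X) ∈ T) →
      ∀ (ttil : (Fin 2 → ℝ) → ℝ) (M : (Fin 2 → ℝ) → Matrix (Fin 4) (Fin 4) ℝ) (C0 : ℝ),
        0 < C0 → Measurable ttil → (∀ i j : Fin 4, Measurable fun X => M X i j) →
        (∀ X ∈ S, ttil X ∈ Set.Icc (0:ℝ) 1) →
        (∀ X ∈ S, ∀ v : Fin 4 → ℝ, norm4v ((M X - 1).mulVec v) ≤ C0 * norm4v v) →
      ∀ (U : Set (Fin 2 → ℝ)) (u : (Fin 2 → ℝ) → (Fin 2 → ℝ)),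
        IsOpen U → T ⊆ U → ContDiffOn ℝ 2 u U →
        (∀ j k l : Fin 2, IntegrableOn (fun X => (Hess (fun Y => u Y j) X k l)^2) T volume) →
        Real.sqrt (∫ X in S, (norm2v
            ((1 - ttil X) • (rowKronI (A - X)).mulVec ((M X - 1).mulVec
              (∫ t in (0:ℝ)..(ttil X),
                deriv (fun s : ℝ => Vec2 (Jac u (X + s • (A - X)))) t))))^2)
          ≤ C * C0 * h^2
            * Real.sqrt (∑ j, ∑ k, ∑ l, ∫ X in T, (Hess (fun Y => u Y j) X k l)^2) := by
  refine ⟨1, one_pos, ?_⟩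
  intro T S hT hS hST A h hh hAX hseg ttil M C0 hC0 _ _ htt hM U u hU hTU hu hint
  have hsum : ∑ j, ∑ k, ∑ l, ∫ X in T, (Hess (fun Y => u Y j) X k l) ^ 2
      = ∫ X in T, hessSq u X := by
    simp only [hessSq]
    rw [integral_finsetSum _ fun j _ => integrable_finsetSum _ fun k _ =>
      integrable_finsetSum _ fun l _ => hint j k l]
    refine Finset.sum_congr rfl fun j _ => ?_
    rw [integral_finsetSum _ fun k _ => integrable_finsetSum _ fun l _ => hint j k l]
    refine Finset.sum_congr rfl fun k _ => ?_
    rw [integral_finsetSum _ fun l _ => hint j k l]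
  have hintQ : IntegrableOn (hessSq u) T :=
    integrable_finsetSum _ fun j _ => integrable_finsetSum _ fun k _ =>
      integrable_finsetSum _ fun l _ => hint j k l
  have hQcont := continuousOn_hessSq hU hu
  classical
  set f : (Fin 2 → ℝ) → ENNReal := T.indicator fun X => ENNReal.ofReal (hessSq u X) with hfdef
  have hf : Measurable f := by
    rw [hfdef, ← Set.piecewise_eq_indicator]
    exact ContinuousOn.measurable_piecewise
      (ENNReal.continuous_ofReal.comp_continuousOn (hQcont.mono hTU)) continuousOn_const hT
  have hfint : ∫⁻ X, f X = ENNReal.ofReal (∫ X in T, hessSq u X) := by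
    rw [hfdef, lintegral_indicator hT,
      ofReal_integral_eq_lintegral_ofReal hintQ (ae_of_all _ (hessSq_nonneg u))]
  have hQ0 : 0 ≤ ∫ X in T, hessSq u X := integral_nonneg (hessSq_nonneg u)
  rw [hsum, one_mul, ← Real.sqrt_sq (by positivity : 0 ≤ C0 * h ^ 2),
    ← Real.sqrt_mul (sq_nonneg _)]
  refine Real.sqrt_le_sqrt ?_
  refine integral_le_of_lintegral_le (ae_of_all _ fun _ => sq_nonneg _) (by positivity) ?_
  rw [ENNReal.ofReal_mul (sq_nonneg _), ← hfint]
  refine le_trans (setLIntegral_mono' hS fun X hX => ?_) <|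
    (lintegral_const_mul' _ _ ENNReal.ofReal_ne_top).trans_le
      (mul_le_mul_right (lintegral_lintegral_comp_segment_le hf S A) _)
  have hsegT : ∀ t ∈ Set.Icc (0 : ℝ) (ttil X), X + t • (A - X) ∈ T := fun t ht =>
    hseg X hX t ⟨ht.1, ht.2.trans (htt X hX).2⟩
  have hr : ∑ i, (A - X) i ^ 2 ≤ h ^ 2 := by
    simpa using (Real.sqrt_le_left hh.le).1 (hAX X hX)
  refine (ENNReal.ofReal_le_ofReal (norm2v_remainder_sq_le hU hu (htt X hX) hr
    (fun t ht => hTU (hsegT t ht)) (hM X hX))).trans ?_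
  rw [ENNReal.ofReal_mul (sq_nonneg _)]
  refine mul_le_mul_right (ofReal_sq_mul_intervalIntegral_le (htt X hX)
    (hQcont.comp (by fun_prop) fun t ht => hTU (hsegT t ht)) (fun _ => hessSq_nonneg _ _)
    fun t ht => ?_) _
  rw [hfdef, Set.indicator_of_mem (hsegT t ht), Function.comp_apply]
end
end

section
/- Let T ⊆ ℝ² and S ⊆ T be Lebesgue measurable sets with S of finite measure |S|, let A ∈ ℝ² and h > 0 be such that ‖A − X‖ ≤ h and tA + (1−t)X ∈ T for all X ∈ S and t ∈ [0,1]. Let u be continuously differentiable on an open set containing T with ‖∇u‖_{L⁶(T)} < ∞. For X ∈ S define R̃(X) = ∫₀¹ ∇u(tA + (1−t)X)·(A−X) dt. Then there is an absolute constant C (one may take C = 3/2) such that (∫_S R̃(X)² dX)^{1/2} ≤ C·h·|S|^{1/3}·‖∇u‖_{L⁶(T)}. In particular, if |S| ≤ c·h³ then (∫_S R̃(X)² dX)^{1/2} ≤ C·c^{1/3}·h²·‖∇u‖_{L⁶(T)}. -/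
open Matrix MeasureTheory intervalIntegral

noncomputable section

/-- The gradient of a scalar function `u : ℝ² → ℝ`. -/
def gradv (u : (Fin 2 → ℝ) → ℝ) (X : Fin 2 → ℝ) : Fin 2 → ℝ :=
  fun i => fderiv ℝ u X (Pi.single i 1)

/-- Hölder's inequality against the constant function `1`. -/
lemma lintegral_le_lintegral_rpow_mul_measure_univ {α : Type*} [MeasurableSpace α]
    (μ : Measure α) {p : ℝ} (hp : 1 < p) {f : α → ENNReal} (hf : AEMeasurable f μ) :
    ∫⁻ x, f x ∂μ ≤ (∫⁻ x, f x ^ p ∂μ) ^ (1 / p) * μ Set.univ ^ (1 - 1 / p) := by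
  have hpq : p.HolderConjugate (Real.conjExponent p) := Real.HolderConjugate.conjExponent hp
  have hq : 1 / Real.conjExponent p = 1 - 1 / p := by
    have := hpq.inv_add_inv_eq_one
    simp only [one_div]
    linarith
  have key := ENNReal.lintegral_mul_le_Lp_mul_Lq μ hpq hf
    (aemeasurable_const (b := (1 : ENNReal)))
  rw [hq] at key
  simpa using key

/-- Change of variables for the contraction of `E` towards a point `A`. -/
lemma lintegral_comp_add_smul_sub {E : Type*} [NormedAddCommGroup E] [NormedSpace ℝ E]
    [MeasurableSpace E] [BorelSpace E] [FiniteDimensional ℝ E] (μ : Measure E)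
    [μ.IsAddHaarMeasure] {F : E → ENNReal} (hF : Measurable F) (A : E) {t : ℝ} (ht : t < 1) :
    ∫⁻ X, F (X + t • (A - X)) ∂μ
      = ENNReal.ofReal (((1 - t) ^ Module.finrank ℝ E)⁻¹) * ∫⁻ X, F X ∂μ := by
  have hr : 0 < 1 - t := sub_pos.2 ht
  have h1 : ∀ X : E, X + t • (A - X) = (1 - t) • X + t • A := fun X => by module
  simp_rw [h1]
  rw [← lintegral_map (f := fun Y => F (Y + t • A)) (g := fun X => (1 - t) • X)
    (by fun_prop) (by fun_prop), Measure.map_addHaar_smul μ hr.ne', lintegral_smul_measure,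
    lintegral_add_right_eq_self, abs_of_pos (by positivity), smul_eq_mul]

lemma lintegral_one_sub_rpow_neg_two_thirds :
    ∫⁻ t in Set.Ioc (0 : ℝ) 1, ENNReal.ofReal ((1 - t) ^ (-(2 : ℝ) / 3)) = 3 := by
  have hintegrable : IntervalIntegrable (fun x : ℝ => x ^ (-(2 : ℝ) / 3)) volume 0 1 :=
    intervalIntegrable_rpow' (by norm_num)
  have hintegrable_sub : IntervalIntegrable (fun t : ℝ => (1 - t) ^ (-(2 : ℝ) / 3)) volume 0 1 := by
    simpa using (hintegrable.comp_sub_left 1).symm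
  rw [← ofReal_integral_eq_lintegral_ofReal
    ((intervalIntegrable_iff_integrableOn_Ioc_of_le zero_le_one).1 hintegrable_sub),
    ← intervalIntegral.integral_of_le zero_le_one,
    intervalIntegral.integral_comp_sub_left (fun x : ℝ => x ^ (-(2 : ℝ) / 3)),
    integral_rpow (Or.inl (by norm_num))]
  · norm_num
  · filter_upwards [ae_restrict_mem measurableSet_Ioc] with t ht
    exact Real.rpow_nonneg (by linarith [ht.2]) _

lemma measurable_norm2v_gradv (u : (Fin 2 → ℝ) → ℝ) :
    Measurable fun X => norm2v (gradv u X) := by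
  unfold norm2v gradv
  have := fun i : Fin 2 => measurable_fderiv_apply_const ℝ u (Pi.single i (1 : ℝ))
  fun_prop

lemma abs_fderiv_le_norm2v_mul (u : (Fin 2 → ℝ) → ℝ) (Y v : Fin 2 → ℝ) :
    |fderiv ℝ u Y v| ≤ norm2v (gradv u Y) * norm2v v := by
  have h1 : fderiv ℝ u Y v = ∑ i, gradv u Y i * v i := by
    conv_lhs => rw [pi_eq_sum_univ' v]
    simp [gradv, map_smul, mul_comm, Fin.sum_univ_two]
  rw [h1, norm2v, norm2v, ← Real.sqrt_mul (by positivity)]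
  exact Real.abs_le_sqrt (Finset.sum_mul_sq_le_sq_mul_sq _ _ _)

/-- The `L²` norm over `S` of a sixth-power-integrable function pulled back by the contraction
towards `A`. -/
lemma lintegral_sq_comp_add_smul_sub_le {T S : Set (Fin 2 → ℝ)} (hT : MeasurableSet T)
    {A : Fin 2 → ℝ} {t : ℝ} (ht : t < 1) (hST : ∀ X ∈ S, X + t • (A - X) ∈ T)
    (hS : MeasurableSet S) {G : (Fin 2 → ℝ) → ENNReal} (hG : Measurable G) :
    ∫⁻ X in S, G (X + t • (A - X)) ^ 2
      ≤ ENNReal.ofReal ((1 - t) ^ (-(2 : ℝ) / 3)) *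
        ((∫⁻ X in T, G X ^ 6) ^ ((1 : ℝ) / 3) * volume S ^ ((2 : ℝ) / 3)) := by
  have hr : 0 < 1 - t := sub_pos.2 ht
  have h6 : ∫⁻ X in S, G (X + t • (A - X)) ^ 6
      ≤ ENNReal.ofReal (((1 - t) ^ 2)⁻¹) * ∫⁻ X in T, G X ^ 6 := by
    have hF : Measurable (T.indicator fun X => G X ^ 6) := (hG.pow_const 6).indicator hT
    have hcov := lintegral_comp_add_smul_sub volume hF A ht
    rw [lintegral_indicator hT, Module.finrank_fin_fun] at hcov
    rw [← hcov]
    refine le_trans (setLIntegral_mono' hS fun X hX => ?_) (setLIntegral_le_lintegral S _)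
    rw [Set.indicator_of_mem (hST X hX)]
  have hH := lintegral_le_lintegral_rpow_mul_measure_univ (volume.restrict S)
    (p := 3) (by norm_num) (f := fun X => G (X + t • (A - X)) ^ 2) (by fun_prop)
  have h23 : ∀ x : ENNReal, (x ^ 2) ^ (3 : ℝ) = x ^ 6 := fun x => by
    rw [← ENNReal.rpow_natCast, ← ENNReal.rpow_mul, ← ENNReal.rpow_natCast]
    norm_num
  simp only [h23, Measure.restrict_apply_univ] at hH
  calc _ ≤ _ := hH
    _ ≤ (ENNReal.ofReal (((1 - t) ^ 2)⁻¹) * ∫⁻ X in T, G X ^ 6) ^ ((1 : ℝ) / 3)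
        * volume S ^ (1 - (1 : ℝ) / 3) := by gcongr
    _ = _ := by
      rw [ENNReal.mul_rpow_of_nonneg _ _ (by norm_num),
        ENNReal.ofReal_rpow_of_pos (by positivity), mul_assoc]
      congr 2
      · rw [← Real.rpow_natCast, ← Real.rpow_neg hr.le, ← Real.rpow_mul hr.le]
        norm_num
      · norm_num

/-- Squared `L²` bound for averages along segments towards `A`. -/
lemma lintegral_sq_lintegral_segment_le {T S : Set (Fin 2 → ℝ)} (hT : MeasurableSet T)
    (hS : MeasurableSet S) {A : Fin 2 → ℝ}
    (hST : ∀ X ∈ S, ∀ t ∈ Set.Icc (0 : ℝ) 1, X + t • (A - X) ∈ T)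
    {G : (Fin 2 → ℝ) → ENNReal} (hG : Measurable G) :
    ∫⁻ X in S, (∫⁻ t in Set.Ioc (0 : ℝ) 1, G (X + t • (A - X))) ^ 2
      ≤ 3 * ((∫⁻ X in T, G X ^ 6) ^ ((1 : ℝ) / 3) * volume S ^ ((2 : ℝ) / 3)) := by
  have hjensen : ∀ X, (∫⁻ t in Set.Ioc (0 : ℝ) 1, G (X + t • (A - X))) ^ 2
      ≤ ∫⁻ t in Set.Ioc (0 : ℝ) 1, G (X + t • (A - X)) ^ 2 := fun X => by
    have hH := lintegral_le_lintegral_rpow_mul_measure_univ (volume.restrict (Set.Ioc (0 : ℝ) 1))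
      (p := 2) (by norm_num) (f := fun t => G (X + t • (A - X))) (by fun_prop)
    simp only [Measure.restrict_apply_univ, Real.volume_Ioc, sub_zero, ENNReal.ofReal_one,
      ENNReal.one_rpow, mul_one, ENNReal.rpow_two] at hH
    calc _ ≤ ((∫⁻ t in Set.Ioc (0 : ℝ) 1, G (X + t • (A - X)) ^ 2) ^ ((1 : ℝ) / 2)) ^ 2 := by
          gcongr
      _ = _ := by
          rw [← ENNReal.rpow_natCast, ← ENNReal.rpow_mul]
          norm_num
  calc _ ≤ ∫⁻ X in S, ∫⁻ t in Set.Ioc (0 : ℝ) 1, G (X + t • (A - X)) ^ 2 :=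
        lintegral_mono hjensen
    _ = ∫⁻ t in Set.Ioc (0 : ℝ) 1, ∫⁻ X in S, G (X + t • (A - X)) ^ 2 :=
        lintegral_lintegral_swap (by unfold Function.uncurry; fun_prop)
    _ ≤ ∫⁻ t in Set.Ioc (0 : ℝ) 1, ENNReal.ofReal ((1 - t) ^ (-(2 : ℝ) / 3)) *
        ((∫⁻ X in T, G X ^ 6) ^ ((1 : ℝ) / 3) * volume S ^ ((2 : ℝ) / 3)) := by
        rw [← restrict_Ioo_eq_restrict_Ioc]
        exact setLIntegral_mono' measurableSet_Ioo fun t ht =>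
          lintegral_sq_comp_add_smul_sub_le hT ht.2
            (fun X hX => hST X hX t ⟨ht.1.le, ht.2.le⟩) hS hG
    _ = _ := by
        rw [lintegral_mul_const _ (by fun_prop), lintegral_one_sub_rpow_neg_two_thirds]

/-- there is an absolute constant `C` (one may take `C = 3/2`) such that the
first-order Taylor remainder `R̃(X) = ∫₀¹ ∇u(tA+(1−t)X)·(A−X) dt` satisfies
`‖R̃‖_{L²(S)} ≤ C·h·|S|^{1/3}·‖∇u‖_{L⁶(T)}`; in particular, if `|S| ≤ c·h³` then
`‖R̃‖_{L²(S)} ≤ C·c^{1/3}·h²·‖∇u‖_{L⁶(T)}`. -/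
theorem first_order_remainder_L2_estimate :
    ∃ C : ℝ, 0 < C ∧
      ∀ (T S : Set (Fin 2 → ℝ)), MeasurableSet T → MeasurableSet S → S ⊆ T →
        volume S < ⊤ →
      ∀ (A : Fin 2 → ℝ) (h : ℝ), 0 < h →
      (∀ X ∈ S, Real.sqrt (∑ i, (A i - X i)^2) ≤ h) →
      (∀ X ∈ S, ∀ t ∈ Set.Icc (0:ℝ) 1, X + t • (A - X) ∈ T) →
      ∀ (U : Set (Fin 2 → ℝ)) (u : (Fin 2 → ℝ) → ℝ),
        IsOpen U → T ⊆ U → ContDiffOn ℝ 1 u U →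
        IntegrableOn (fun X => (norm2v (gradv u X))^6) T volume →
        (Real.sqrt (∫ X in S,
              (∫ t in (0:ℝ)..1, fderiv ℝ u (X + t • (A - X)) (A - X))^2)
            ≤ C * h * ((volume S).toReal) ^ ((1:ℝ)/3)
              * (∫ X in T, (norm2v (gradv u X))^6) ^ ((1:ℝ)/6)) ∧
        (∀ c : ℝ, (volume S).toReal ≤ c * h^3 →
          Real.sqrt (∫ X in S,
              (∫ t in (0:ℝ)..1, fderiv ℝ u (X + t • (A - X)) (A - X))^2)
            ≤ C * c ^ ((1:ℝ)/3) * h^2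
              * (∫ X in T, (norm2v (gradv u X))^6) ^ ((1:ℝ)/6)) := by
  refine ⟨√3, by positivity, ?_⟩
  intro T S hT hS _ hSfin A h hh hAX hseg U u _ _ _ hintegrable
  have hG : Measurable fun X => ENNReal.ofReal (norm2v (gradv u X)) :=
    (measurable_norm2v_gradv u).ennreal_ofReal
  have hn : ∀ X, 0 ≤ norm2v (gradv u X) := fun X => Real.sqrt_nonneg _
  set I : ℝ := ∫ X in T, (norm2v (gradv u X)) ^ 6 with hI
  have hI0 : 0 ≤ I := integral_nonneg fun X => by have := hn X; positivity
  have hK : ∫⁻ X in T, ENNReal.ofReal (norm2v (gradv u X)) ^ 6 = ENNReal.ofReal I := by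
    rw [hI, ofReal_integral_eq_lintegral_ofReal hintegrable
      (ae_of_all _ fun X => by have := hn X; positivity)]
    simp only [ENNReal.ofReal_pow (hn _)]
  have hpt : ∀ X ∈ S,
      ‖(∫ t in (0 : ℝ)..1, fderiv ℝ u (X + t • (A - X)) (A - X)) ^ 2‖ₑ
        ≤ ENNReal.ofReal h ^ 2 * (∫⁻ t in Set.Ioc (0 : ℝ) 1,
          ENNReal.ofReal (norm2v (gradv u (X + t • (A - X))))) ^ 2 := by
    intro X hX
    rw [enorm_pow, ← mul_pow, intervalIntegral.integral_of_le zero_le_one]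
    gcongr
    refine (enorm_integral_le_lintegral_enorm _).trans ?_
    rw [← lintegral_const_mul' _ _ ENNReal.ofReal_ne_top]
    refine lintegral_mono fun t => ?_
    rw [← ofReal_norm, ← ENNReal.ofReal_mul hh.le, Real.norm_eq_abs, mul_comm h]
    exact ENNReal.ofReal_le_ofReal ((abs_fderiv_le_norm2v_mul u _ _).trans
      (mul_le_mul_of_nonneg_left (hAX X hX) (hn _)))
  have hlin : ∫⁻ X in S, ‖(∫ t in (0 : ℝ)..1, fderiv ℝ u (X + t • (A - X)) (A - X)) ^ 2‖ₑ
      ≤ ENNReal.ofReal (h ^ 2 * (3 * (I ^ ((1 : ℝ) / 3) *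
          (volume S).toReal ^ ((2 : ℝ) / 3)))) := by
    refine (setLIntegral_mono' hS hpt).trans ?_
    rw [lintegral_const_mul' _ _ (by finiteness), ENNReal.ofReal_mul (by positivity),
      ENNReal.ofReal_mul (by positivity), ENNReal.ofReal_mul (by positivity),
      ENNReal.ofReal_pow hh.le, ← ENNReal.ofReal_rpow_of_nonneg hI0 (by norm_num),
      ← ENNReal.ofReal_rpow_of_nonneg ENNReal.toReal_nonneg (by norm_num),
      ENNReal.ofReal_toReal hSfin.ne, ← hK, ENNReal.ofReal_ofNat]
    gcongr
    exact lintegral_sq_lintegral_segment_le hT hS hseg hG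
  have hmain : √(∫ X in S, (∫ t in (0 : ℝ)..1, fderiv ℝ u (X + t • (A - X)) (A - X)) ^ 2)
      ≤ √3 * h * (volume S).toReal ^ ((1 : ℝ) / 3) * I ^ ((1 : ℝ) / 6) := by
    refine Real.sqrt_le_iff.2 ⟨by positivity, ?_⟩
    have hsq : (√3 * h * (volume S).toReal ^ ((1 : ℝ) / 3) * I ^ ((1 : ℝ) / 6)) ^ 2
        = h ^ 2 * (3 * (I ^ ((1 : ℝ) / 3) * (volume S).toReal ^ ((2 : ℝ) / 3))) := by
      simp only [mul_pow]
      rw [Real.sq_sqrt (by norm_num), ← Real.rpow_mul_natCast hI0,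
        ← Real.rpow_mul_natCast ENNReal.toReal_nonneg]
      norm_num
      ring
    rw [hsq]
    refine (Real.le_norm_self _).trans ((ENNReal.ofReal_le_ofReal_iff (by positivity)).1 ?_)
    rw [ofReal_norm]
    exact (enorm_integral_le_lintegral_enorm _).trans hlin
  refine ⟨hmain, fun c hc => hmain.trans ?_⟩
  have hc0 : 0 ≤ c := nonneg_of_mul_nonneg_left (ENNReal.toReal_nonneg.trans hc) (by positivity)
  have hSc : (volume S).toReal ^ ((1 : ℝ) / 3) ≤ c ^ ((1 : ℝ) / 3) * h := by
    calc _ ≤ (c * h ^ 3) ^ ((1 : ℝ) / 3) := by gcongr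
      _ = _ := by
        rw [Real.mul_rpow hc0 (by positivity), ← Real.rpow_natCast, ← Real.rpow_mul hh.le]
        norm_num
  calc _ ≤ √3 * h * (c ^ ((1 : ℝ) / 3) * h) * I ^ ((1 : ℝ) / 6) := by gcongr
    _ = _ := by ring
end
end
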